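/- (Calibration–refinement trade-off.) Let ℓ be a bounded scoring loss and Q a PMF on X × Y. For every predictor h : X → Δ^Y, CE_Q(h,ℓ) = R_Q(h,ℓ) − RF_Q(h,ℓ). Consequently, for any two predictors h₁, h₂ with equal risk R_Q(h₁,ℓ) = R_Q(h₂,ℓ), one has CE_Q(h₁,ℓ) − CE_Q(h₂,ℓ) = RF_Q(h₂,ℓ) − RF_Q(h₁,ℓ): at a fixed risk level, any decrease in refinement error is exactly compensated by an equal increase in calibration error. -/

import Mathlib

open Finset
open scoped Classical

noncomputable section

/-- The standard probability simplex over a finite type `Y`. -/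
def simplex (Y : Type*) [Fintype Y] : Set (Y → ℝ) :=
  {p | (∀ y, 0 ≤ p y) ∧ ∑ y, p y = 1}

variable {X Y : Type*}

/-- Expected loss `L(p,q) = Σ_y p(y)·ℓ(y,q)`. -/
def expLoss [Fintype Y] (ℓ : Y → (Y → ℝ) → ℝ) (p q : Y → ℝ) : ℝ :=
  ∑ y, p y * ℓ y q

/-- A scoring loss is bounded by `M` if `0 ≤ ℓ(y,q) ≤ M` for all `y` and `q ∈ Δ^Y`. -/
def IsBoundedLoss [Fintype Y] (ℓ : Y → (Y → ℝ) → ℝ) (M : ℝ) : Prop :=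
  ∀ y : Y, ∀ q ∈ simplex Y, 0 ≤ ℓ y q ∧ ℓ y q ≤ M

/-- A scoring loss is proper if `L(p,p) ≤ L(p,q)` for all `p, q ∈ Δ^Y`. -/
def IsProper [Fintype Y] (ℓ : Y → (Y → ℝ) → ℝ) : Prop :=
  ∀ p ∈ simplex Y, ∀ q ∈ simplex Y, expLoss ℓ p p ≤ expLoss ℓ p q

/-- Generalized entropy `H_ℓ(p) = inf_{q ∈ Δ^Y} L(p,q)`. -/
def genEnt [Fintype Y] (ℓ : Y → (Y → ℝ) → ℝ) (p : Y → ℝ) : ℝ :=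
  sInf ((fun q => expLoss ℓ p q) '' simplex Y)

/-- Bregman divergence `d_ℓ(p,q) = L(p,q) − H_ℓ(p)`. -/
def breg [Fintype Y] (ℓ : Y → (Y → ℝ) → ℝ) (p q : Y → ℝ) : ℝ :=
  expLoss ℓ p q - genEnt ℓ p

/-- A probability mass function on `X × Y`. -/
def IsPMF [Fintype X] [Fintype Y] (P : X × Y → ℝ) : Prop :=
  (∀ z, 0 ≤ P z) ∧ ∑ z, P z = 1

/-- The `X`-marginal `P_X(x) = Σ_y P(x,y)`. -/
def margX [Fintype Y] (P : X × Y → ℝ) (x : X) : ℝ := ∑ y, P (x, y)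

/-- The conditional distribution `P(·|x)`. -/
def condY [Fintype Y] (P : X × Y → ℝ) (x : X) : Y → ℝ :=
  fun y => P (x, y) / margX P x

/-- Risk `R_P(h,ℓ) = Σ_{x,y} P(x,y)·ℓ(y,h(x))`. -/
def risk [Fintype X] [Fintype Y] (P : X × Y → ℝ) (h : X → Y → ℝ)
    (ℓ : Y → (Y → ℝ) → ℝ) : ℝ :=
  ∑ z : X × Y, P z * ℓ z.2 (h z.1)

/-- The weight `w_ν = Σ_{x : h(x)=ν} P_X(x)`. -/
def weight [Fintype X] [Fintype Y] (P : X × Y → ℝ) (h : X → Y → ℝ) (ν : Y → ℝ) : ℝ :=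
  ∑ x ∈ univ.filter (fun x => h x = ν), margX P x

/-- The conditional outcome distribution `P(·|h=ν)`. -/
def condOut [Fintype X] [Fintype Y] (P : X × Y → ℝ) (h : X → Y → ℝ) (ν : Y → ℝ) : Y → ℝ :=
  fun y => (∑ x ∈ univ.filter (fun x => h x = ν), P (x, y)) / weight P h ν

/-- `h` is canonically calibrated under `P` if `P(·|h=ν) = ν` whenever `w_ν > 0`. -/
def Calibrated [Fintype X] [Fintype Y] (P : X × Y → ℝ) (h : X → Y → ℝ) : Prop :=
  ∀ ν : Y → ℝ, 0 < weight P h ν → condOut P h ν = ν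

/-- Calibration error `CE_P(h,ℓ) = Σ_{ν : w_ν>0} w_ν · d_ℓ(P(·|h=ν), ν)`,
the sum ranging over the (finitely many) values in the range of `h`. -/
def CE [Fintype X] [Fintype Y] (P : X × Y → ℝ) (h : X → Y → ℝ)
    (ℓ : Y → (Y → ℝ) → ℝ) : ℝ :=
  ∑ ν ∈ (univ.image h).filter (fun ν => 0 < weight P h ν),
    weight P h ν * breg ℓ (condOut P h ν) ν

/-- Refinement `RF_P(h,ℓ) = Σ_{ν : w_ν>0} w_ν · H_ℓ(P(·|h=ν))`. -/
def RF [Fintype X] [Fintype Y] (P : X × Y → ℝ) (h : X → Y → ℝ)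
    (ℓ : Y → (Y → ℝ) → ℝ) : ℝ :=
  ∑ ν ∈ (univ.image h).filter (fun ν => 0 < weight P h ν),
    weight P h ν * genEnt ℓ (condOut P h ν)

/-- Bayes refinement `B_P(ℓ) = Σ_{x : P_X(x)>0} P_X(x) · H_ℓ(P(·|x))`. -/
def BayesRF [Fintype X] [Fintype Y] (P : X × Y → ℝ) (ℓ : Y → (Y → ℝ) → ℝ) : ℝ :=
  ∑ x ∈ univ.filter (fun x => 0 < margX P x), margX P x * genEnt ℓ (condY P x)

/-- The optimal (Bayes) value `V(Q) = inf_{h : X → Δ^Y} R_Q(h,ℓ)`. -/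
def mdlV [Fintype X] [Fintype Y] (ℓ : Y → (Y → ℝ) → ℝ) (Q : X × Y → ℝ) : ℝ :=
  sInf {r : ℝ | ∃ h : X → Y → ℝ, (∀ x, h x ∈ simplex Y) ∧ r = risk Q h ℓ}

theorem weight_mul_expLoss_condOut [Fintype X] [Fintype Y] (P : X × Y → ℝ) (h : X → Y → ℝ)
    (ℓ : Y → (Y → ℝ) → ℝ) {ν : Y → ℝ} (hν : weight P h ν ≠ 0) :
    weight P h ν * expLoss ℓ (condOut P h ν) ν =
      ∑ x ∈ univ.filter (fun x => h x = ν), ∑ y, P (x, y) * ℓ y ν := by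
  rw [expLoss, mul_sum, sum_comm]
  refine sum_congr rfl fun y _ => ?_
  rw [condOut, ← mul_assoc, mul_div_cancel₀ _ hν, sum_mul]

theorem IsPMF.eq_zero_of_not_weight_pos [Fintype X] [Fintype Y] {P : X × Y → ℝ} (hP : IsPMF P)
    {h : X → Y → ℝ} {x : X} (hw : ¬ 0 < weight P h (h x)) (y : Y) : P (x, y) = 0 := by
  have hmarg : ∀ x', 0 ≤ margX P x' := fun x' => sum_nonneg fun y' _ => hP.1 (x', y')
  have hle_weight : margX P x ≤ weight P h (h x) :=
    single_le_sum (f := margX P) (fun x' _ => hmarg x') (by simp)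
  have hle_margX : P (x, y) ≤ margX P x :=
    single_le_sum (f := fun y' => P (x, y')) (fun y' _ => hP.1 (x, y')) (mem_univ y)
  linarith [hP.1 (x, y)]

theorem IsPMF.sum_weight_mul_expLoss_condOut [Fintype X] [Fintype Y] {P : X × Y → ℝ}
    (hP : IsPMF P) (h : X → Y → ℝ) (ℓ : Y → (Y → ℝ) → ℝ) :
    ∑ ν ∈ (univ.image h).filter (fun ν => 0 < weight P h ν),
      weight P h ν * expLoss ℓ (condOut P h ν) ν = risk P h ℓ := by
  calc
    _ = ∑ ν ∈ (univ.image h).filter (fun ν => 0 < weight P h ν),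
          ∑ x ∈ univ.filter (fun x => h x = ν), ∑ y, P (x, y) * ℓ y (h x) := by
      refine sum_congr rfl fun ν hν => ?_
      rw [weight_mul_expLoss_condOut P h ℓ (mem_filter.1 hν).2.ne']
      refine sum_congr rfl fun x hx => ?_
      rw [(mem_filter.1 hx).2]
    _ = ∑ ν ∈ univ.image h,
          ∑ x ∈ univ.filter (fun x => h x = ν), ∑ y, P (x, y) * ℓ y (h x) := by
      refine sum_subset (filter_subset _ _) fun ν hmem hnot => ?_
      refine sum_eq_zero fun x hx => sum_eq_zero fun y _ => ?_
      obtain rfl := (mem_filter.1 hx).2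
      rw [hP.eq_zero_of_not_weight_pos (fun hw => hnot (mem_filter.2 ⟨hmem, hw⟩)), zero_mul]
    _ = ∑ x, ∑ y, P (x, y) * ℓ y (h x) :=
      sum_fiberwise_of_maps_to (fun x hx => mem_image_of_mem h hx) _
    _ = risk P h ℓ := by rw [risk, Fintype.sum_prod_type]

theorem IsPMF.CE_eq_risk_sub_RF [Fintype X] [Fintype Y] {P : X × Y → ℝ} (hP : IsPMF P)
    (h : X → Y → ℝ) (ℓ : Y → (Y → ℝ) → ℝ) : CE P h ℓ = risk P h ℓ - RF P h ℓ := by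
  simp only [CE, RF, breg, mul_sub, sum_sub_distrib, hP.sum_weight_mul_expLoss_condOut h ℓ]

/-- calibration–refinement trade-off: `CE_Q(h,ℓ) = R_Q(h,ℓ) − RF_Q(h,ℓ)`,
so at a fixed risk level any decrease in refinement error is exactly compensated by an
equal increase in calibration error. -/
theorem calibration_refinement_tradeoff
    [Fintype X] [Fintype Y] [Nonempty X] [Nonempty Y]
    (ℓ : Y → (Y → ℝ) → ℝ) (M : ℝ) (hb : IsBoundedLoss ℓ M)
    (Q : X × Y → ℝ) (hQ : IsPMF Q) :
    (∀ h : X → Y → ℝ, (∀ x, h x ∈ simplex Y) →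
      CE Q h ℓ = risk Q h ℓ - RF Q h ℓ) ∧
    (∀ h₁ h₂ : X → Y → ℝ, (∀ x, h₁ x ∈ simplex Y) → (∀ x, h₂ x ∈ simplex Y) →
      risk Q h₁ ℓ = risk Q h₂ ℓ →
      CE Q h₁ ℓ - CE Q h₂ ℓ = RF Q h₂ ℓ - RF Q h₁ ℓ) := by
  refine ⟨fun h _ => hQ.CE_eq_risk_sub_RF h ℓ, fun h₁ h₂ _ _ hrisk => ?_⟩
  rw [hQ.CE_eq_risk_sub_RF, hQ.CE_eq_risk_sub_RF, hrisk]
  ring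

end
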